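/- Let G be a finite connected simple graph that is K_4-free and P_5-free (contains no induced subgraph isomorphic to the complete graph K_4 nor to the path on 5 vertices). Then for every finite simple graph H, γ(G □ H) ≥ γ(G)·γ(H). -/

import Mathlib

open SimpleGraph Finset

/-- `S` is a dominating set of `G`: every vertex is in `S` or adjacent to a vertex of `S`. -/
def IsDomSet {V : Type*} (G : SimpleGraph V) (S : Finset V) : Prop :=
  ∀ v : V, v ∈ S ∨ ∃ u ∈ S, G.Adj u v

/-- The domination number of a finite graph. -/
noncomputable def domNum {V : Type*} [Fintype V] (G : SimpleGraph V) : ℕ :=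
  sInf {n | ∃ S : Finset V, S.card = n ∧ IsDomSet G S}

/-- `G` is `H`-free: `G` has no induced subgraph isomorphic to `H`,
equivalently there is no graph embedding of `H` into `G`. -/
def IsFree {V W : Type*} (G : SimpleGraph V) (H : SimpleGraph W) : Prop :=
  ¬ Nonempty (H ↪g G)

section Domination

variable {V W : Type*}

theorem domNum_le_card [Fintype V] {G : SimpleGraph V} {S : Finset V} (hS : IsDomSet G S) :
    domNum G ≤ S.card :=
  Nat.sInf_le ⟨S, rfl, hS⟩

theorem exists_isDomSet_card_eq_domNum [Fintype V] (G : SimpleGraph V) :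
    ∃ S : Finset V, S.card = domNum G ∧ IsDomSet G S :=
  Nat.sInf_mem (s := {n | ∃ S : Finset V, S.card = n ∧ IsDomSet G S})
    ⟨_, Finset.univ, rfl, fun v => Or.inl (Finset.mem_univ v)⟩

theorem exists_maximal_indep [Finite W] (H : SimpleGraph W) (K : Set W) :
    ∃ T ⊆ K, (∀ a ∈ T, ∀ b ∈ T, ¬ H.Adj a b) ∧ ∀ h ∈ K, h ∈ T ∨ ∃ t ∈ T, H.Adj t h := by
  obtain ⟨T, hT⟩ :=
    (Set.toFinite {T : Set W | T ⊆ K ∧ ∀ a ∈ T, ∀ b ∈ T, ¬ H.Adj a b}).exists_maximal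
    ⟨∅, by simp⟩
  refine ⟨T, hT.prop.1, hT.prop.2, fun h hh => ?_⟩
  by_contra! hcon
  refine hcon.1 (hT.le_of_ge (y := insert h T) ⟨Set.insert_subset hh hT.prop.1, ?_⟩
    (Set.subset_insert h T) (Set.mem_insert h T))
  rintro a (rfl | ha) b (rfl | hb)
  · exact H.irrefl
  · exact fun hab => hcon.2 b hb hab.symm
  · exact hcon.2 a ha
  · exact hT.prop.2 a ha b hb

/-- A family of fibres `D h ⊆ V`, `h ∈ W`, forming a dominating set of `G □ H`. -/
def Covers (G : SimpleGraph V) (H : SimpleGraph W) (D : W → Finset V) : Prop :=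
  ∀ h y, (∀ x ∈ D h, Gᶜ.Adj x y) → ∃ h', H.Adj h h' ∧ y ∈ D h'

theorem exists_covers_sum_card_eq [Fintype V] [Fintype W] (G : SimpleGraph V)
    (H : SimpleGraph W) : ∃ D : W → Finset V, Covers G H D ∧ ∑ h, (D h).card = domNum (G □ H) := by
  classical
  obtain ⟨S, hS, hdom⟩ := exists_isDomSet_card_eq_domNum (G □ H)
  refine ⟨fun h => Finset.univ.filter fun x => (x, h) ∈ S, fun h y hy => ?_, ?_⟩
  · simp only [Finset.mem_filter, Finset.mem_univ, true_and] at hy ⊢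
    rcases hdom (y, h) with hmem | ⟨⟨x, k⟩, hmem, hadj⟩
    · exact absurd (hy y hmem) Gᶜ.irrefl
    · rw [boxProd_adj] at hadj
      rcases hadj with ⟨hxy, rfl⟩ | ⟨hkh, rfl⟩
      · exact absurd hxy ((compl_adj _ _ _).1 (hy x hmem)).2
      · exact ⟨k, hkh.symm, hmem⟩
  · rw [← hS, Finset.card_eq_sum_card_fiberwise (f := Prod.snd) (t := Finset.univ) (by simp)]
    refine Finset.sum_congr rfl fun h _ => ?_
    refine Finset.card_bij (fun x _ => (x, h)) ?_ ?_ ?_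
    · simp
    · simp
    · rintro ⟨x, k⟩ hx
      simp only [Finset.mem_filter] at hx
      obtain ⟨hx, rfl⟩ := hx
      exact ⟨x, by simpa using hx, rfl⟩

open Classical in
theorem mul_domNum_le_sum [Fintype W] {H : SimpleGraph W} {k : ℕ} (S : Fin k → W → Prop)
    (hS : ∀ i h, S i h ∨ ∃ u, S i u ∧ H.Adj u h) (f : W → ℕ)
    (hf : ∀ h, (∑ i, if S i h then 1 else 0) ≤ f h) : k * domNum H ≤ ∑ h, f h := by
  calc k * domNum H = ∑ _i : Fin k, domNum H := by simp
    _ ≤ ∑ i, (Finset.univ.filter (S i)).card :=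
        Finset.sum_le_sum fun i _ => domNum_le_card fun h => by simpa using hS i h
    _ = ∑ i, ∑ h, if S i h then 1 else 0 := by simp
    _ = ∑ h, ∑ i, if S i h then 1 else 0 := Finset.sum_comm
    _ ≤ ∑ h, f h := Finset.sum_le_sum fun h _ => hf h

theorem domNum_le_sum_of_covers [Fintype W] {G : SimpleGraph V} {H : SimpleGraph W}
    {D : W → Finset V} (hD : Covers G H D) (v : V) : domNum H ≤ ∑ h, (D h).card := by
  classical
  have := mul_domNum_le_sum (H := H) (k := 1) (fun _ h => (D h).Nonempty)
    (fun _ h => ?_) (fun h => (D h).card) (fun h => ?_)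
  · simpa using this
  · by_cases hh : (D h).Nonempty
    · exact Or.inl hh
    · rw [Finset.not_nonempty_iff_eq_empty] at hh
      obtain ⟨k, hk, hv⟩ := hD h v (by simp [hh])
      exact Or.inr ⟨k, ⟨v, hv⟩, hk.symm⟩
  · simp only [Finset.univ_unique, Finset.sum_singleton]
    split_ifs with hh
    · exact hh.card_pos
    · simp

theorem two_mul_domNum_le_sum_of_covers [Fintype W] {G : SimpleGraph V} {H : SimpleGraph W}
    {D : W → Finset V} (hD : Covers G H D) (hG : ∀ x, ∃ z, Gᶜ.Adj x z) (v : V) :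
    2 * domNum H ≤ ∑ h, (D h).card := by
  classical
  obtain ⟨T, hTK, hTi, hTm⟩ := exists_maximal_indep H
    {h | v ∉ D h ∧ ∀ k, H.Adj h k → v ∉ D k}
  have hTx : ∀ h ∈ T, ∃ x ∈ D h, G.Adj x v := by
    intro h hh
    by_contra! hcon
    obtain ⟨k, hk, hv⟩ := hD h v fun x hx =>
      (compl_adj _ _ _).2 ⟨fun h' => (hTK hh).1 (h' ▸ hx), hcon x hx⟩
    exact (hTK hh).2 k hk hv
  have key : ∀ h k, H.Adj h k → ∀ z ∈ D k, (Gᶜ.Adj v z ∨ h ∈ T) →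
      (if v ∈ D k ∨ k ∈ T then 1 else 0) + 1 ≤ (D k).card := by
    intro h k hhk z hz hor
    split_ifs with hk
    · refine Finset.one_lt_card.2 ?_
      rcases hor with hvz | hh
      · rcases hk with hk | hk
        · exact ⟨v, hk, z, hz, hvz.ne⟩
        · obtain ⟨x, hx, hxv⟩ := hTx k hk
          refine ⟨x, hx, z, hz, ?_⟩
          rintro rfl
          exact ((compl_adj _ _ _).1 hvz).2 hxv.symm
      · rcases hk with hk | hk
        · exact absurd hk ((hTK hh).2 k hhk)
        · exact absurd hhk (hTi h hh k hk)
    · simpa using Finset.card_pos.2 ⟨z, hz⟩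
  have := mul_domNum_le_sum (H := H) (k := 2)
    ![fun h => v ∈ D h ∨ h ∈ T, fun h => (if v ∈ D h ∨ h ∈ T then 1 else 0) + 1 ≤ (D h).card]
    ?_ (fun h => (D h).card) (fun h => ?_)
  · simpa using this
  · intro i
    fin_cases i
    · intro h
      simp only [Fin.zero_eta, Matrix.cons_val_zero]
      by_cases hP : v ∈ D h
      · exact Or.inl (Or.inl hP)
      by_cases hP' : ∃ k, H.Adj h k ∧ v ∈ D k
      · obtain ⟨k, hk, hv⟩ := hP'
        exact Or.inr ⟨k, Or.inl hv, hk.symm⟩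
      push Not at hP'
      rcases hTm h ⟨hP, hP'⟩ with hh | ⟨t, ht, hadj⟩
      · exact Or.inl (Or.inr hh)
      · exact Or.inr ⟨t, Or.inr ht, hadj⟩
    · intro h
      simp only [Fin.mk_one, Matrix.cons_val_one, Matrix.cons_val_fin_one]
      by_contra! hcon
      obtain ⟨h1, h2⟩ := hcon
      have fin : ∀ z, (Gᶜ.Adj v z ∨ h ∈ T) → ¬ ∀ x ∈ D h, Gᶜ.Adj x z := by
        intro z hz hall
        obtain ⟨k, hk, hzk⟩ := hD h z hall
        exact h2 k (key h k hk z hzk hz) hk.symm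
      rcases Nat.lt_or_ge 0 (D h).card with hpos | hz
      · have hmem : v ∈ D h ∨ h ∈ T := by
          by_contra hm
          rw [if_neg hm] at h1
          omega
        rw [if_pos hmem] at h1
        obtain ⟨y, hy⟩ := Finset.card_eq_one.1 (by omega : (D h).card = 1)
        obtain ⟨z, hz⟩ := hG y
        refine fin z ?_ (by simpa [hy] using hz)
        refine hmem.imp_left fun hv => ?_
        rw [hy, Finset.mem_singleton] at hv
        rwa [hv]
      · have : D h = ∅ := Finset.card_eq_zero.1 (by omega)
        obtain ⟨z, hz⟩ := hG v
        exact fin z (Or.inl hz) (by simp [this])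
  · simp only [Fin.sum_univ_two, Matrix.cons_val_zero, Matrix.cons_val_one]
    by_cases hm : v ∈ D h ∨ h ∈ T
    · have : 1 ≤ (D h).card := by
        rcases hm with hm | hm
        · exact Finset.card_pos.2 ⟨v, hm⟩
        · obtain ⟨x, hx, -⟩ := hTx h hm
          exact Finset.card_pos.2 ⟨x, hx⟩
      simp only [hm, if_true]
      split_ifs <;> omega
    · simp only [hm, if_false]
      split_ifs <;> omega

end Domination

section Three

variable {V W : Type*}

theorem three_mul_domNum_le_sum_of_covers [Fintype W] {G : SimpleGraph V} {H : SimpleGraph W}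
    {D : W → Finset V} (hD : Covers G H D) (hG : ∀ x y, ∃ z, Gᶜ.Adj x z ∧ Gᶜ.Adj y z)
    {v u : V} {J : Set V} (hJ : ∀ a ∈ J, ∀ b ∈ J, ¬ Gᶜ.Adj a b) (hJv : ∀ a ∈ J, Gᶜ.Adj v a)
    (hJmax : ∀ y, Gᶜ.Adj v y → y ∉ J → ∃ z ∈ J, Gᶜ.Adj y z) (huv : Gᶜ.Adj v u) (huJ : u ∉ J)
    (hu : ∀ x, G.Adj v x → ∃ z, Gᶜ.Adj x z ∧ Gᶜ.Adj u z ∧ (G.Adj v z ∨ z ∈ J)) :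
    3 * domNum H ≤ ∑ h, (D h).card := by
  classical
  have hne : ∀ {x y}, Gᶜ.Adj x y → x ≠ y ∧ ¬ G.Adj x y := fun h => (compl_adj _ _ _).1 h
  have hor : ∀ x, x = v ∨ G.Adj v x ∨ Gᶜ.Adj v x := fun x => by
    rw [compl_adj]; tauto
  let b : V → Prop := fun y => y ∈ J ∨ (G.Adj v y ∧ ∀ z ∈ J, ¬ Gᶜ.Adj y z)
  have hbJ : ∀ z ∈ J, b z := fun z hz => Or.inl hz
  have hbR : ∀ z, Gᶜ.Adj v z → z ∉ J → ¬ b z := fun z hz hzJ hb =>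
    hb.elim hzJ fun h => (hne hz).2 h.1
  have hbX : ∀ z, G.Adj v z → ∀ q ∈ J, Gᶜ.Adj z q → ¬ b z := fun z hz q hq hzq hb =>
    hb.elim (fun h => (hne (hJv z h)).2 hz) fun h => h.2 q hq hzq
  obtain ⟨q, hq⟩ : ∃ q, q ∈ J := (hJmax u huv huJ).imp fun _ h => h.1
  have hopp : ∀ y, y ≠ v → ∃ z, Gᶜ.Adj v z ∧ Gᶜ.Adj y z ∧ (b z ↔ ¬ b y) := by
    intro y hyv
    obtain ⟨z, hvz, hyz⟩ := hG v y
    rcases (hor y).resolve_left hyv with hy | hy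
    · by_cases hs : ∃ z ∈ J, Gᶜ.Adj y z
      · obtain ⟨w, hw, hyw⟩ := hs
        exact ⟨w, hJv w hw, hyw, iff_of_true (hbJ w hw) (hbX y hy w hw hyw)⟩
      · push Not at hs
        exact ⟨z, hvz, hyz, iff_of_false (hbR z hvz fun h => hs z h hyz)
          (not_not.2 (Or.inr ⟨hy, hs⟩))⟩
    · by_cases hyJ : y ∈ J
      · exact ⟨z, hvz, hyz, iff_of_false (hbR z hvz fun h => hJ y hyJ z h hyz)
          (not_not.2 (hbJ y hyJ))⟩
      · obtain ⟨w, hw, hyw⟩ := hJmax y hy hyJ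
        exact ⟨w, hJv w hw, hyw, iff_of_true (hbJ w hw) (hbR y hy hyJ)⟩
  let bi : V → Prop := fun x =>
    G.Adj v x ∧ (∃ z ∈ J, Gᶜ.Adj x z) ∧ ∃ z, z ∉ J ∧ Gᶜ.Adj v z ∧ Gᶜ.Adj x z
  let Good : W → Prop := fun h => ∃ x, D h = {x} ∧ bi x
  obtain ⟨T, hTK, hTi, hTm⟩ := exists_maximal_indep H
    {h | ¬ (v ∈ D h ∨ Good h) ∧ ∀ k, H.Adj h k → ¬ (v ∈ D k ∨ Good k)}
  have hTx : ∀ h, ∃ x, h ∈ T → x ∈ D h ∧ G.Adj v x := by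
    intro h
    by_cases hh : h ∈ T
    · by_contra! hcon
      obtain ⟨k, hk, hv⟩ := hD h v fun x hx => (compl_adj _ _ _).2
        ⟨fun h' => (hTK hh).1 (Or.inl (h' ▸ hx)), fun h' => (hcon x).2 hx h'.symm⟩
      exact (hTK hh).2 k hk (Or.inl hv)
    · exact ⟨v, fun h => absurd h hh⟩
  choose t ht using hTx
  let E : W → Finset V := fun h => (D h).filter fun y => y ≠ v ∧ (h ∈ T → y ≠ t h) ∧ ¬ Good h
  have hE : ∀ h y, y ∈ E h ↔ y ∈ D h ∧ y ≠ v ∧ (h ∈ T → y ≠ t h) ∧ ¬ Good h := fun h y => by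
    simp [E]
  have hED : ∀ h, E h ⊆ D h := fun h => Finset.filter_subset _ _
  -- a fibre adjacent to one in `T` loses no vertex
  have hTnb : ∀ h ∈ T, ∀ k, H.Adj h k → E k = D k ∧ k ∉ T ∧ ¬ Good k := by
    intro h hh k hk
    have h1 := (hTK hh).2 k hk
    push Not at h1
    have h2 : k ∉ T := fun hkT => hTi h hh k hkT hk
    refine ⟨Finset.Subset.antisymm (hED k) fun y hy => ?_, h2, h1.2⟩
    exact (hE k y).2 ⟨hy, fun e => h1.1 (e ▸ hy), fun h' => absurd h' h2, h1.2⟩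
  have hRE : ∀ k z, z ∈ D k → Gᶜ.Adj v z → z ∈ E k := by
    intro k z hz hvz
    refine (hE k z).2 ⟨hz, (hne hvz).1.symm, fun hk e => (hne hvz).2 (e ▸ (ht k hk).2), ?_⟩
    rintro ⟨x, hx, hbi⟩
    rw [hx, Finset.mem_singleton] at hz
    exact (hne hvz).2 (hz ▸ hbi.1)
  let Okb : W → Prop → Prop := fun h i => 2 ≤ (E h).card ∨ ∃ y ∈ E h, (b y ↔ i)
  let Flip : W → Prop := fun h => h ∈ T ∧ ∃ y, E h = {y} ∧ ¬ ∃ k, H.Adj h k ∧ Okb k (¬ b y)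
  let Ok : W → Prop → Prop := fun h i => 2 ≤ (E h).card ∨ ∃ y ∈ E h, ((b y ↔ i) ↔ ¬ Flip h)
  have hOk : ∀ h i, ¬ Flip h → Okb h i → Ok h i := by
    rintro h i hf (h1 | ⟨y, hy, hi⟩)
    · exact Or.inl h1
    · exact Or.inr ⟨y, hy, iff_of_true hi hf⟩
  have hOkT : ∀ h i, h ∉ T → Okb h i → Ok h i := fun h i hh => hOk h i fun hf => hh hf.1
  have hcard : ∀ h, (if v ∈ D h ∨ Good h ∨ h ∈ T then 1 else 0) + (E h).card ≤ (D h).card := by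
    intro h
    split_ifs with hh
    · suffices h1 : (E h).card < (D h).card by omega
      refine Finset.card_lt_card (Finset.ssubset_iff_subset_ne.2 ⟨hED h, fun e => ?_⟩)
      rcases hh with hh | hh | hh
      · exact ((hE h v).1 (e ▸ hh)).2.1 rfl
      · obtain ⟨x, hx, -⟩ := id hh
        exact ((hE h x).1 (e ▸ hx ▸ Finset.mem_singleton_self x)).2.2.2 hh
      · exact ((hE h (t h)).1 (e ▸ (ht h hh).1)).2.2.1 hh rfl
    · simpa using Finset.card_le_card (hED h)
  have hEG : ∀ h, v ∉ D h → h ∉ T → ¬ Good h → ∀ x ∈ D h, x ∈ E h := fun h hv hh hg x hx =>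
    (hE h x).2 ⟨hx, fun e => hv (e ▸ hx), fun h' => absurd h' hh, hg⟩
  have hTE : ∀ h ∈ T, ∀ x ∈ D h, x = t h ∨ x ∈ E h := by
    intro h hh x hx
    have h1 := (hTK hh).1
    push Not at h1
    by_cases hxt : x = t h
    · exact Or.inl hxt
    · exact Or.inr ((hE h x).2 ⟨hx, fun e => h1.1 (e ▸ hx), fun _ => hxt, h1.2⟩)
  have hTk : ∀ h ∈ T, ∀ z, (∀ x ∈ D h, Gᶜ.Adj x z) →
      ∃ k, H.Adj h k ∧ z ∈ E k ∧ D k = E k ∧ k ∉ T ∧ ¬ Good k := by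
    intro h hh z hz
    obtain ⟨k, hk, hzk⟩ := hD h z hz
    obtain ⟨h1, h2⟩ := hTnb h hh k hk
    exact ⟨k, hk, h1 ▸ hzk, h1.symm, h2⟩
  have hR : ∀ h, (∀ k, H.Adj h k → k ∉ T) → ∀ z, Gᶜ.Adj v z → (∀ x ∈ D h, Gᶜ.Adj x z) →
      ∀ i, (b z ↔ i) → ∃ k, H.Adj h k ∧ Ok k i := by
    intro h hh z hvz hz i hi
    obtain ⟨k, hk, hzk⟩ := hD h z hz
    exact ⟨k, hk, hOkT k i (hh k hk) (Or.inr ⟨z, hRE k z hzk hvz, hi⟩)⟩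
  have hbp : ∀ x z p, G.Adj v x → Gᶜ.Adj x z → p ∈ J → Gᶜ.Adj p z → ¬ b z := by
    intro x z p hx hxz hp hpz
    rcases hor z with rfl | hz | hz
    · exact absurd hx.symm (hne hxz).2
    · exact hbX z hz p hp hpz.symm
    · exact hbR z hz fun h => hJ p hp z h hpz
  have hX : ∀ k z, z ∈ E k → D k = E k → ¬ Good k → Gᶜ.Adj u z → (G.Adj v z ∨ z ∈ J) →
      Okb k True := by
    intro k z hz hk hg huz hvz
    rcases hvz with hvz | hzJ
    · rcases Nat.lt_or_ge (E k).card 2 with h2 | h2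
      · refine Or.inr ⟨z, hz, iff_true_intro (Or.inr ⟨hvz, fun p hp hzp => hg ⟨z, ?_, hvz,
          ⟨p, hp, hzp⟩, u, huJ, huv, huz.symm⟩⟩)⟩
        have hpos := Finset.card_pos.2 ⟨z, hz⟩
        obtain ⟨y, hy⟩ := Finset.card_eq_one.1 (by omega : (E k).card = 1)
        rw [hy, Finset.mem_singleton] at hz
        rw [hk, hy, hz]
      · exact Or.inl h2
    · exact Or.inr ⟨z, hz, iff_true_intro (hbJ z hzJ)⟩
  have hcases : ∀ h, 2 ≤ (E h).card ∨ (∃ y, E h = {y}) ∨ E h = ∅ := by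
    intro h
    rcases Nat.lt_or_ge (E h).card 2 with h2 | h2
    · right
      interval_cases hc : (E h).card
      · exact Or.inr (Finset.card_eq_zero.1 hc)
      · exact Or.inl (Finset.card_eq_one.1 hc)
    · exact Or.inl h2
  have hlow : ∀ h i, i = True ∨ i = False → Ok h i ∨ ∃ k, H.Adj h k ∧ Ok k i := by
    intro h i hi
    by_cases hh : h ∈ T
    · rcases hcases h with h2 | ⟨y, hy⟩ | h0
      · exact Or.inl (Or.inl h2)
      · have hyE : y ∈ E h := hy ▸ Finset.mem_singleton_self y
        by_cases hf : Flip h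
        · obtain ⟨-, y', hy', hno⟩ := id hf
          obtain rfl : y = y' := by simpa [hy] using hy'
          by_cases hbi : b y ↔ i
          · obtain ⟨z, hz1, hz2⟩ := hG (t h) y
            obtain ⟨k, hk, hzk, -, hkT, -⟩ := hTk h hh z fun x hx => by
              rcases hTE h hh x hx with rfl | hx
              · exact hz1
              · rw [hy, Finset.mem_singleton] at hx
                exact hx ▸ hz2
            refine Or.inr ⟨k, hk, hOkT k i hkT (Or.inr ⟨z, hzk, ?_⟩)⟩
            by_contra hzi
            exact hno ⟨k, hk, Or.inr ⟨z, hzk,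
              (not_iff_comm.1 ((not_iff.1 hzi).trans hbi.symm)).symm⟩⟩
          · exact Or.inl (Or.inr ⟨y, hyE, iff_of_false hbi (not_not.2 hf)⟩)
        · by_cases hbi : b y ↔ i
          · exact Or.inl (hOk h i hf (Or.inr ⟨y, hyE, hbi⟩))
          · obtain ⟨k, hk, hok⟩ : ∃ k, H.Adj h k ∧ Okb k (¬ b y) := by
              by_contra hno
              exact hf ⟨hh, y, hy, hno⟩
            rw [show (¬ b y) = i from propext (not_iff.1 hbi)] at hok
            exact Or.inr ⟨k, hk, hOkT k i (hTnb h hh k hk).2.1 hok⟩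
      · have hDh : ∀ x ∈ D h, x = t h := fun x hx =>
          (hTE h hh x hx).resolve_right (by simp [h0])
        have hnb : ∀ z, Gᶜ.Adj (t h) z →
            ∃ k, H.Adj h k ∧ z ∈ E k ∧ D k = E k ∧ k ∉ T ∧ ¬ Good k := fun z hz =>
          hTk h hh z fun x hx => hDh x hx ▸ hz
        have hvx := (ht h hh).2
        right
        by_cases hs : ∃ p ∈ J, Gᶜ.Adj (t h) p
        · obtain ⟨p, hp, hxp⟩ := hs
          rcases hi with rfl | rfl
          · obtain ⟨k, hk, hzk, -, hkT, -⟩ := hnb p hxp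
            exact ⟨k, hk, hOkT k _ hkT (Or.inr ⟨p, hzk, iff_true_intro (hbJ p hp)⟩)⟩
          · obtain ⟨z, hz1, hz2⟩ := hG (t h) p
            obtain ⟨k, hk, hzk, -, hkT, -⟩ := hnb z hz1
            exact ⟨k, hk, hOkT k _ hkT (Or.inr ⟨z, hzk, iff_false_intro
              (hbp _ z p hvx hz1 hp hz2)⟩)⟩
        · push Not at hs
          rcases hi with rfl | rfl
          · obtain ⟨z, hz1, hz2, hz3⟩ := hu (t h) hvx
            obtain ⟨k, hk, hzk, hkE, hkT, hkg⟩ := hnb z hz1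
            exact ⟨k, hk, hOkT k _ hkT (hX k z hzk hkE hkg hz2 hz3)⟩
          · obtain ⟨z, hz1, hz2⟩ := hG v (t h)
            obtain ⟨k, hk, hzk, -, hkT, -⟩ := hnb z hz2
            exact ⟨k, hk, hOkT k _ hkT (Or.inr ⟨z, hzk, iff_false_intro
              (hbR z hz1 fun hzJ => hs z hzJ hz2)⟩)⟩
    by_cases hP : v ∈ D h
    · have hg : ¬ Good h := by
        rintro ⟨x, hx, hbi⟩
        rw [hx, Finset.mem_singleton] at hP
        exact (hP ▸ hbi.1.ne) rfl
      have hnT : ∀ k, H.Adj h k → k ∉ T := fun k hk hkT => (hTK hkT).2 h hk.symm (Or.inl hP)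
      have hDE : ∀ x ∈ D h, x = v ∨ x ∈ E h := fun x hx => by
        by_cases hxv : x = v
        · exact Or.inl hxv
        · exact Or.inr ((hE h x).2 ⟨hx, hxv, fun h' => absurd h' hh, hg⟩)
      rcases hcases h with h2 | ⟨y, hy⟩ | h0
      · exact Or.inl (Or.inl h2)
      · have hyE : y ∈ E h := hy ▸ Finset.mem_singleton_self y
        by_cases hbi : b y ↔ i
        · exact Or.inl (hOkT h i hh (Or.inr ⟨y, hyE, hbi⟩))
        · obtain ⟨z, hz1, hz2, hz3⟩ := hopp y ((hE h y).1 hyE).2.1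
          refine Or.inr (hR h hnT z hz1 (fun x hx => ?_) i (hz3.trans (not_iff.1 hbi)))
          rcases hDE x hx with rfl | hx
          · exact hz1
          · rw [hy, Finset.mem_singleton] at hx
            exact hx ▸ hz2
      · have hDh : ∀ x ∈ D h, x = v := fun x hx => (hDE x hx).resolve_right (by simp [h0])
        rcases hi with rfl | rfl
        · exact Or.inr (hR h hnT q (hJv q hq) (fun x hx => hDh x hx ▸ hJv q hq) _
            (iff_true_intro (hbJ q hq)))
        · exact Or.inr (hR h hnT u huv (fun x hx => hDh x hx ▸ huv) _
            (iff_false_intro (hbR u huv huJ)))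
    by_cases hg : Good h
    · have hnT : ∀ k, H.Adj h k → k ∉ T := fun k hk hkT => (hTK hkT).2 h hk.symm (Or.inr hg)
      obtain ⟨x, hx, -, ⟨z1, hz1, hxz1⟩, z2, hz2, hvz2, hxz2⟩ := hg
      rcases hi with rfl | rfl
      · exact Or.inr (hR h hnT z1 (hJv z1 hz1) (by simpa [hx] using hxz1) _
          (iff_true_intro (hbJ z1 hz1)))
      · exact Or.inr (hR h hnT z2 hvz2 (by simpa [hx] using hxz2) _
          (iff_false_intro (hbR z2 hvz2 hz2)))
    rcases hcases h with h2 | ⟨y, hy⟩ | h0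
    · exact Or.inl (Or.inl h2)
    · have hyE : y ∈ E h := hy ▸ Finset.mem_singleton_self y
      by_cases hbi : b y ↔ i
      · exact Or.inl (hOkT h i hh (Or.inr ⟨y, hyE, hbi⟩))
      · obtain ⟨z, hz1, hz2, hz3⟩ := hopp y ((hE h y).1 hyE).2.1
        obtain ⟨k, hk, hzk⟩ := hD h z fun x hx => by
          have := hEG h hP hh hg x hx
          rw [hy, Finset.mem_singleton] at this
          exact this ▸ hz2
        have hzE := hRE k z hzk hz1
        refine Or.inr ⟨k, hk, hOk k i ?_ (Or.inr ⟨z, hzE, hz3.trans (not_iff.1 hbi)⟩)⟩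
        rintro ⟨-, y', hy', hno⟩
        rw [hy', Finset.mem_singleton] at hzE
        subst hzE
        exact hno ⟨h, hk.symm, Or.inr ⟨y, hyE, (not_iff_comm.1 hz3.symm).symm⟩⟩
    · have hDh : ∀ x, x ∉ D h := fun x hx => by simpa [h0] using hEG h hP hh hg x hx
      -- a fibre `{x, y}` in `T` that lost `x` sees every common non-neighbour of `x` and `y`
      have hpair : ∀ k ∈ T, ∀ y, E k = {y} → ∀ z, Gᶜ.Adj (t k) z → Gᶜ.Adj y z →
          ∃ l, H.Adj k l ∧ z ∈ E l ∧ D l = E l ∧ l ∉ T ∧ ¬ Good l := by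
        intro k hk y hy z hz1 hz2
        refine hTk k hk z fun x hx => ?_
        rcases hTE k hk x hx with rfl | hx
        · exact hz1
        · rw [hy, Finset.mem_singleton] at hx
          exact hx ▸ hz2
      rcases hi with rfl | rfl
      · obtain ⟨k, hk, hqk⟩ := hD h q fun x hx => absurd hx (hDh x)
        have hqE := hRE k q hqk (hJv q hq)
        refine Or.inr ⟨k, hk, hOk k _ ?_ (Or.inr ⟨q, hqE, iff_true_intro (hbJ q hq)⟩)⟩
        rintro ⟨hkT, y, hy, hno⟩
        rw [hy, Finset.mem_singleton] at hqE
        subst hqE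
        obtain ⟨z, hz1, hz2⟩ := hG (t k) q
        obtain ⟨l, hl, hzl, -⟩ := hpair k hkT q hy z hz1 hz2
        exact hno ⟨l, hl, Or.inr ⟨z, hzl, iff_of_false (hbp _ z q (ht k hkT).2 hz1 hq hz2)
          (not_not.2 (hbJ q hq))⟩⟩
      · obtain ⟨k, hk, huk⟩ := hD h u fun x hx => absurd hx (hDh x)
        have huE := hRE k u huk huv
        have hbu := hbR u huv huJ
        refine Or.inr ⟨k, hk, hOk k _ ?_ (Or.inr ⟨u, huE, iff_false_intro hbu⟩)⟩
        rintro ⟨hkT, y, hy, hno⟩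
        rw [hy, Finset.mem_singleton] at huE
        subst huE
        obtain ⟨z, hz1, hz2, hz3⟩ := hu (t k) (ht k hkT).2
        obtain ⟨l, hl, hzl, hlE, -, hlg⟩ := hpair k hkT u hy z hz1 hz2
        refine hno ⟨l, hl, ?_⟩
        rw [eq_true hbu]
        exact hX l z hzl hlE hlg hz2 hz3
  have := mul_domNum_le_sum (H := H) (k := 3)
    ![fun h => v ∈ D h ∨ Good h ∨ h ∈ T, fun h => Ok h True, fun h => Ok h False]
    ?_ (fun h => (D h).card) (fun h => ?_)
  · exact this
  · intro i h
    fin_cases i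
    · simp only [Fin.zero_eta, Matrix.cons_val_zero]
      by_contra hcon
      rcases hTm h ⟨fun h' => hcon (Or.inl (h'.imp_right Or.inl)), fun k hk h' =>
        hcon (Or.inr ⟨k, h'.imp_right Or.inl, hk.symm⟩)⟩ with hh | ⟨k, hk, hkh⟩
      · exact hcon (Or.inl (Or.inr (Or.inr hh)))
      · exact hcon (Or.inr ⟨k, Or.inr (Or.inr hk), hkh⟩)
    · exact (hlow h True (Or.inl rfl)).imp_right fun ⟨k, hk, hk'⟩ => ⟨k, hk', hk.symm⟩
    · exact (hlow h False (Or.inr rfl)).imp_right fun ⟨k, hk, hk'⟩ => ⟨k, hk', hk.symm⟩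
  · simp only [Fin.sum_univ_three, Matrix.cons_val_zero, Matrix.cons_val_one, Matrix.cons_val]
    refine le_trans ?_ (hcard h)
    rw [add_assoc]
    refine add_le_add (le_of_eq (by congr)) ?_
    have hle : ∀ (p : Prop) {_ : Decidable p}, (if p then 1 else 0 : ℕ) ≤ 1 := fun p _ => by
      split_ifs <;> simp
    rcases Nat.lt_or_ge (E h).card 2 with h2 | h2
    · have hE1 : ∀ i, Ok h i → ∃ y ∈ E h, ((b y ↔ i) ↔ ¬ Flip h) := fun i hi =>
        hi.resolve_left (by omega)
      by_cases h0 : E h = ∅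
      · have hno : ∀ i, ¬ Ok h i := fun i hi => by
          obtain ⟨y, hy, -⟩ := hE1 i hi
          simp [h0] at hy
        simp [hno]
      · have hpos := Finset.card_pos.2 (Finset.nonempty_iff_ne_empty.2 h0)
        obtain ⟨y, hy⟩ := Finset.card_eq_one.1 (by omega : (E h).card = 1)
        have hnot : ¬ (Ok h True ∧ Ok h False) := by
          rintro ⟨h1, h1'⟩
          obtain ⟨y1, hy1, e1⟩ := hE1 _ h1
          obtain ⟨y2, hy2, e2⟩ := hE1 _ h1'
          rw [hy, Finset.mem_singleton] at hy1 hy2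
          subst hy1 hy2
          rw [iff_true] at e1
          rw [iff_false] at e2
          exact iff_not_self (e1.trans e2.symm)
        by_cases h1 : Ok h True
        · simp [h1, show ¬ Ok h False from fun h1' => hnot ⟨h1, h1'⟩, hy]
        · simpa [h1, hy] using hle _
    · exact (add_le_add (hle _) (hle _)).trans h2

end Three

section Forbidden

variable {V : Type*} {G : SimpleGraph V}

theorem IsFree.not_pathGraph_five (hG : IsFree G (pathGraph 5)) (a b c d e : V)
    (h : G.Adj a b ∧ G.Adj b c ∧ G.Adj c d ∧ G.Adj d e ∧ ¬ G.Adj a c ∧ ¬ G.Adj a d ∧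
      ¬ G.Adj a e ∧ ¬ G.Adj b d ∧ ¬ G.Adj b e ∧ ¬ G.Adj c e) : False := by
  obtain ⟨hab, hbc, hcd, hde, hac, had, hae, hbd, hbe, hce⟩ := h
  have key : ∀ i j, G.Adj (![a, b, c, d, e] i) (![a, b, c, d, e] j) ↔ (pathGraph 5).Adj i j := by
    intro i j
    rw [pathGraph_adj]
    fin_cases i <;> fin_cases j <;> simp [hab, hbc, hcd, hde, hac, had, hae, hbd, hbe, hce,
      hab.symm, hbc.symm, hcd.symm, hde.symm, mt Adj.symm hac, mt Adj.symm had, mt Adj.symm hae,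
      mt Adj.symm hbd, mt Adj.symm hbe, mt Adj.symm hce]
  refine hG ⟨⟨⟨![a, b, c, d, e], fun i j hij => ?_⟩, fun {i j} => key i j⟩⟩
  have h : ∀ k, (pathGraph 5).Adj i k ↔ (pathGraph 5).Adj j k := fun k => by
    rw [← key, ← key, hij]
  simp only [pathGraph_adj] at h
  fin_cases i <;> fin_cases j <;> first | rfl | exact absurd h (by decide)

theorem IsFree.not_top_four (hG : IsFree G (⊤ : SimpleGraph (Fin 4))) (a b c d : V)
    (h : G.Adj a b ∧ G.Adj a c ∧ G.Adj a d ∧ G.Adj b c ∧ G.Adj b d ∧ G.Adj c d) : False := by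
  obtain ⟨hab, hac, had, hbc, hbd, hcd⟩ := h
  have key : ∀ i j, G.Adj (![a, b, c, d] i) (![a, b, c, d] j) ↔
      (⊤ : SimpleGraph (Fin 4)).Adj i j := by
    intro i j
    rw [top_adj]
    fin_cases i <;> fin_cases j <;> simp [hab, hac, had, hbc, hbd, hcd, hab.symm, hac.symm,
      had.symm, hbc.symm, hbd.symm, hcd.symm]
  refine hG ⟨⟨⟨![a, b, c, d], fun i j hij => ?_⟩, fun {i j} => key i j⟩⟩
  by_contra hne
  exact G.irrefl (hij ▸ (key i j).2 hne)

end Forbidden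

section GoodPair

variable {V : Type*} {G : SimpleGraph V}

/-- The common non-neighbours of `x` and `y`. -/
def coNbrs (G : SimpleGraph V) (x y : V) : Set V := {z | Gᶜ.Adj x z ∧ Gᶜ.Adj y z}

theorem exists_common_neighbor_coNbrs_ssubset [Finite V]
    (hG : ∀ u v, Gᶜ.Adj u v → ∃ x, G.Adj v x ∧ coNbrs G u x ⊂ coNbrs G u v)
    {u v : V} (huv : Gᶜ.Adj u v) :
    ∃ f, G.Adj f u ∧ G.Adj f v ∧ coNbrs G u f ⊂ coNbrs G u v ∧
      ∀ z, G.Adj z v → G.Adj z u ∨ G.Adj z f := by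
  obtain ⟨hne, hnadj⟩ := (compl_adj _ _ _).1 huv
  obtain ⟨x, hx⟩ := (Set.toFinite {x | x ≠ u ∧ coNbrs G u x ⊂ coNbrs G u v}).exists_minimalFor
    (fun x => coNbrs G u x) _
    (by
      obtain ⟨x, hx, hlt⟩ := hG u v huv
      exact ⟨x, fun h => hnadj (h ▸ hx.symm), hlt⟩)
  have hxu : G.Adj u x := by
    by_contra hcon
    obtain ⟨y, hy, hlt⟩ := hG u x ((compl_adj _ _ _).2 ⟨hx.prop.1.symm, hcon⟩)
    exact hlt.2 (hx.le_of_le ⟨fun h => hcon (h ▸ hy.symm), hlt.trans hx.prop.2⟩ hlt.1)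
  have hsub : ∀ z, Gᶜ.Adj u z → ¬ Gᶜ.Adj v z → z = x ∨ G.Adj x z := by
    intro z hz hvz
    by_contra! hcon
    exact hvz (hx.prop.2.1 ⟨hz, (compl_adj _ _ _).2 ⟨hcon.1.symm, hcon.2⟩⟩).2
  refine ⟨x, hxu.symm, ?_, hx.prop.2, fun z hz => ?_⟩
  · rcases hsub v huv Gᶜ.irrefl with rfl | h
    · exact absurd hxu hnadj
    · exact h
  · by_contra! hcon
    have hzu : z ≠ u := by
      rintro rfl
      exact hnadj hz
    rcases hsub z ((compl_adj _ _ _).2 ⟨hzu.symm, fun h => hcon.1 h.symm⟩)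
      (fun h => ((compl_adj _ _ _).1 h).2 hz.symm) with rfl | h
    · exact hcon.1 hxu.symm
    · exact hcon.2 h.symm

theorem exists_coNbrs_not_ssubset [Finite V] [Nonempty V] (hK4 : IsFree G (⊤ : SimpleGraph (Fin 4)))
    (hP5 : IsFree G (pathGraph 5)) (hG : ∀ x y, (coNbrs G x y).Nonempty) :
    ∃ u v, Gᶜ.Adj u v ∧ ∀ x, G.Adj v x → ¬ coNbrs G u x ⊂ coNbrs G u v := by
  by_contra! hcon
  have hf := fun u v => exists_common_neighbor_coNbrs_ssubset (u := u) (v := v) hcon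
  obtain ⟨⟨u, x⟩, hux⟩ :=
    (Set.toFinite (Set.univ : Set (V × V))).exists_minimalFor
      (fun p => coNbrs G p.1 p.2) _ Set.univ_nonempty
  have hmax : ∀ s t, ¬ coNbrs G s t ⊂ coNbrs G u x := fun s t h =>
    h.2 (hux.le_of_le (j := (s, t)) (Set.mem_univ _) h.1)
  have hor : ∀ a z, ¬ Gᶜ.Adj a z → z = a ∨ G.Adj a z := fun a z h => by
    by_contra! h'
    exact h ((compl_adj _ _ _).2 ⟨h'.1.symm, h'.2⟩)
  have hadj : G.Adj u x := by
    rcases eq_or_ne u x with rfl | hne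
    · obtain ⟨z, hz, -⟩ := hG u u
      refine absurd ?_ (hmax u z)
      exact ⟨fun w hw => ⟨hw.1, hw.1⟩, fun h => Gᶜ.irrefl (h ⟨hz, hz⟩).2⟩
    · by_contra h
      obtain ⟨f, -, -, hf, -⟩ := hf u x ((compl_adj _ _ _).2 ⟨hne, h⟩)
      exact hmax u f hf
  obtain ⟨r, hru, hrx⟩ := hG u x
  have hmax' : ∀ s t, (Gᶜ.Adj s r → ¬ Gᶜ.Adj t r) → ∃ z, Gᶜ.Adj s z ∧ Gᶜ.Adj t z ∧
      (z = u ∨ G.Adj u z ∨ z = x ∨ G.Adj x z) := by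
    intro s t hst
    by_contra! hcon
    refine hmax s t ⟨fun z hz => ?_, fun h => hst (h ⟨hru, hrx⟩).1 (h ⟨hru, hrx⟩).2⟩
    obtain ⟨h1, h2, h3, h4⟩ := hcon z hz.1 hz.2
    exact ⟨(compl_adj _ _ _).2 ⟨h1.symm, h2⟩, (compl_adj _ _ _).2 ⟨h3.symm, h4⟩⟩
  obtain ⟨s, hsr, hsu, -, hs⟩ := hf r u hru.symm
  obtain ⟨t, htr, htx, -, ht⟩ := hf r x hrx.symm
  obtain ⟨w, hwx, hwr, -, hw⟩ := hf x r hrx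
  obtain ⟨b, hb1, hb2, hb3⟩ := hmax' x s fun _ h => ((compl_adj _ _ _).1 h).2 hsr
  obtain ⟨q, hq1, hq2, hq3⟩ := hmax' r s fun h => absurd h Gᶜ.irrefl
  obtain ⟨p, hp1, hp2, hp3⟩ := hmax' r t fun h => absurd h Gᶜ.irrefl
  obtain ⟨d, hd1, hd2, hd3⟩ := hmax' x w fun _ h => ((compl_adj _ _ _).1 h).2 hwr
  simp only [compl_adj] at hru hrx hb1 hb2 hq1 hq2 hp1 hp2 hd1 hd2
  clear hcon hux hmax hor hG hmax'
  have hsx : G.Adj s x := by clear hf; grind [G.adj_comm]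
  have htu : G.Adj t u := by clear hf; grind [G.adj_comm]
  have hst : ¬ G.Adj s t := by
    have := hK4.not_top_four u x s t
    clear hf
    grind [G.adj_comm]
  obtain ⟨c, hcs, hct, -, hc⟩ := hf s t ((compl_adj _ _ _).2 ⟨by clear hf; grind [G.adj_comm], hst⟩)
  clear hf
  have hbu : G.Adj b u := by
    grind [G.adj_comm]
  have hbr : G.Adj b r := by
    grind [G.adj_comm]
  have hbw : G.Adj b w := by
    grind [G.adj_comm]
  have hqu : ¬ G.Adj q u := by
    grind [G.adj_comm]
  have hqx : G.Adj q x := by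
    grind [G.adj_comm]
  have hqt : G.Adj q t := by
    grind [G.adj_comm]
  have hpx : ¬ G.Adj p x := by
    grind [G.adj_comm]
  have hpu : G.Adj p u := by
    grind [G.adj_comm]
  have hps : G.Adj p s := by
    grind [G.adj_comm]
  have hdu : G.Adj d u := by
    grind [G.adj_comm]
  have hdr : ¬ G.Adj d r := by
    grind [G.adj_comm]
  have hds : G.Adj d s := by
    grind [G.adj_comm]
  have hqc : G.Adj q c := by
    grind [G.adj_comm]
  have hpd : ¬ G.Adj p d := by
    have := hK4.not_top_four u s p d
    grind [G.adj_comm]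
  have hxc : ¬ G.Adj x c := by
    have := hK4.not_top_four x t q c
    grind [G.adj_comm]
  have hbq : G.Adj b q := by
    have := hP5.not_pathGraph_five r b u x q
    grind [G.adj_comm]
  have huw : G.Adj u w := by
    have := hP5.not_pathGraph_five r w x u d
    grind [G.adj_comm]
  have hsw : ¬ G.Adj s w := by
    have := hK4.not_top_four u x s w
    grind [G.adj_comm]
  have htw : ¬ G.Adj t w := by
    have := hK4.not_top_four u x t w
    grind [G.adj_comm]
  have hbd : G.Adj b d := by
    have := hP5.not_pathGraph_five b w x s d
    grind [G.adj_comm]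
  have hqp : G.Adj q p := by
    have := hP5.not_pathGraph_five q t r s p
    grind [G.adj_comm]
  have htb : ¬ G.Adj t b := by
    intro htb
    have hbc : G.Adj b c := by grind [G.adj_comm]
    exact hK4.not_top_four t b q c ⟨htb, hqt.symm, hct.symm, hbq, hbc, hqc⟩
  have hbp : ¬ G.Adj b p := by
    have := hP5.not_pathGraph_five x t r b p
    grind [G.adj_comm]
  have htd : G.Adj t d := by
    have := hP5.not_pathGraph_five x t r b d
    grind [G.adj_comm]
  have hwp : ¬ G.Adj w p := by
    have := hP5.not_pathGraph_five t d s p w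
    grind [G.adj_comm]
  have := hP5.not_pathGraph_five b w x s p
  grind [G.adj_comm]

end GoodPair

section CoNbrs

variable {V W : Type*}

theorem three_mul_domNum_le_sum [Finite V] [Nonempty V] [Fintype W] {G : SimpleGraph V}
    (hK4 : IsFree G (⊤ : SimpleGraph (Fin 4))) (hP5 : IsFree G (pathGraph 5))
    (hG : ∀ x y, (coNbrs G x y).Nonempty) {H : SimpleGraph W} {D : W → Finset V}
    (hD : Covers G H D) : 3 * domNum H ≤ ∑ h, (D h).card := by
  obtain ⟨u, v, huv, hgood⟩ := exists_coNbrs_not_ssubset hK4 hP5 hG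
  obtain ⟨q, huq, hvq⟩ := hG u v
  obtain ⟨T, hTK, hTi, hTm⟩ := exists_maximal_indep Gᶜ {r | Gᶜ.Adj v r ∧ G.Adj q r}
  have hTq : ∀ a ∈ T, ¬ Gᶜ.Adj q a := fun a ha h => ((compl_adj _ _ _).1 h).2 (hTK ha).2
  refine three_mul_domNum_le_sum_of_covers hD hG (v := v) (u := u) (J := insert q T) ?_ ?_ ?_
    huv.symm ?_ ?_
  · rintro a (rfl | ha) b (rfl | hb)
    · exact Gᶜ.irrefl
    · exact hTq b hb
    · exact fun h => hTq a ha h.symm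
    · exact hTi a ha b hb
  · rintro a (rfl | ha)
    · exact hvq
    · exact (hTK ha).1
  · intro y hvy hy
    by_cases hqy : G.Adj q y
    · obtain hyT | ⟨z, hz, hzy⟩ := hTm y ⟨hvy, hqy⟩
      · exact absurd (Or.inr hyT) hy
      · exact ⟨z, Or.inr hz, hzy.symm⟩
    · exact ⟨q, Or.inl rfl, (compl_adj _ _ _).2 ⟨fun h => hy (Or.inl h), fun h => hqy h.symm⟩⟩
  · rintro (rfl | hu)
    · exact Gᶜ.irrefl huq
    · exact hTq u hu huq.symm
  · intro x hvx
    by_contra! hcon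
    have hsub : coNbrs G u x ⊆ coNbrs G u v := fun z hz => by
      refine ⟨hz.1, (compl_adj _ _ _).2 ⟨?_, fun h => (hcon z hz.2 hz.1).1 h⟩⟩
      rintro rfl
      exact ((compl_adj _ _ _).1 hz.2).2 hvx.symm
    have hq : q ∈ coNbrs G u x := by
      by_contra hq
      exact hgood x hvx ⟨hsub, fun h => hq (h ⟨huq, hvq⟩)⟩
    exact (hcon q hq.2 hq.1).2 (Or.inl rfl)

end CoNbrs

section ConnectedDomination

variable {V : Type*} {G : SimpleGraph V}

/-- `S` is nonempty and induces a connected subgraph of `G`: an edge leaves every proper nonempty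
subset of `S`. -/
def ConnSet (G : SimpleGraph V) (S : Finset V) : Prop :=
  S.Nonempty ∧ ∀ T ⊆ S, T.Nonempty → T ≠ S → ∃ a ∈ T, ∃ b ∈ S, b ∉ T ∧ G.Adj a b

theorem connSet_univ [Fintype V] (hG : G.Connected) : ConnSet G Finset.univ := by
  obtain ⟨v⟩ := hG.nonempty
  refine ⟨⟨v, Finset.mem_univ v⟩, fun T _ ⟨a, ha⟩ hT => ?_⟩
  obtain ⟨b, hb⟩ : ∃ b, b ∉ T := by
    by_contra! h
    exact hT (Finset.eq_univ_of_forall h)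
  obtain ⟨p⟩ := hG.preconnected a b
  obtain ⟨d, -, h1, h2⟩ := p.exists_boundary_dart (T : Set V)
    (by simpa using ha) (by simpa using hb)
  exact ⟨d.fst, by simpa using h1, d.snd, Finset.mem_univ _, by simpa using h2, d.adj⟩

theorem ConnSet.insert_of_adj [DecidableEq V] {C : Finset V} (hC : ConnSet G C)
    {a b : V} (ha : a ∈ C)
    (hab : G.Adj a b) : ConnSet G (insert b C) := by
  refine ⟨⟨b, Finset.mem_insert_self b C⟩, fun T hT hT0 hTne => ?_⟩
  by_cases h0 : (T ∩ C).Nonempty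
  · by_cases hCT : C ⊆ T
    · refine ⟨a, hCT ha, b, Finset.mem_insert_self b C, fun hb => ?_, hab⟩
      exact hTne (hT.antisymm (Finset.insert_subset hb hCT))
    · obtain ⟨x, hx, y, hy, hyT, hxy⟩ := hC.2 (T ∩ C) Finset.inter_subset_right h0
        fun h => hCT (Finset.inter_eq_right.1 h)
      exact ⟨x, (Finset.mem_inter.1 hx).1, y, Finset.mem_insert_of_mem hy,
        fun h => hyT (Finset.mem_inter.2 ⟨h, hy⟩), hxy⟩
  · obtain ⟨x, hx⟩ := hT0
    have hTC : ∀ y ∈ T, y ∉ C := fun y hy hyC => h0 ⟨y, Finset.mem_inter.2 ⟨hy, hyC⟩⟩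
    obtain rfl : x = b := (Finset.mem_insert.1 (hT hx)).resolve_right (hTC x hx)
    exact ⟨x, hx, a, Finset.mem_insert_of_mem ha, fun h => hTC a h ha, hab.symm⟩

theorem connSet_of_forall_adj {S : Finset V} {p : V} (hp : p ∈ S)
    (hS : ∀ a ∈ S, a ≠ p → G.Adj p a) : ConnSet G S := by
  refine ⟨⟨p, hp⟩, fun T hT ⟨a, ha⟩ hTne => ?_⟩
  by_cases hpT : p ∈ T
  · obtain ⟨b, hb, hbT⟩ : ∃ b ∈ S, b ∉ T := by
      by_contra! h
      exact hTne (hT.antisymm h)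
    exact ⟨p, hpT, b, hb, hbT, hS b hb fun h => hbT (h ▸ hpT)⟩
  · exact ⟨a, ha, p, hp, hpT, (hS a (hT ha) fun h => hpT (h ▸ ha)).symm⟩

theorem ConnSet.exists_erase [DecidableEq V] {C S : Finset V} (hS : ConnSet G S)
    (hC : ConnSet G C) (hCS : C ⊂ S) : ∃ x ∈ S, x ∉ C ∧ ConnSet G (S.erase x) := by
  obtain ⟨M, hM⟩ := (S.powerset.finite_toSet.subset (t := {M | C ⊆ M ∧ M ⊂ S ∧ ConnSet G M})
    fun M hM => by simpa using hM.2.1.1).exists_maximal ⟨C, subset_rfl, hCS, hC⟩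
  obtain ⟨hCM, hMS, hMc⟩ := hM.prop
  obtain ⟨a, ha, b, hb, hbM, hab⟩ := hS.2 M hMS.1 hMc.1 hMS.ne
  have hbC : b ∉ C := fun h => hbM (hCM h)
  have hins := hMc.insert_of_adj ha hab
  by_cases h : insert b M = S
  · refine ⟨b, hb, hbC, ?_⟩
    rwa [← h, Finset.erase_insert hbM]
  · refine absurd (hM.le_of_ge (y := insert b M) ⟨hCM.trans (Finset.subset_insert b M), ?_, hins⟩
      (Finset.subset_insert b M) (Finset.mem_insert_self b M)) hbM
    exact (Finset.insert_subset hb hMS.1).ssubset_of_ne h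

/-- `D` is a connected dominating set of minimum size. -/
def IsMinConnDom (G : SimpleGraph V) (D : Finset V) : Prop :=
  ConnSet G D ∧ IsDomSet G D ∧ ∀ D', ConnSet G D' → IsDomSet G D' → D.card ≤ D'.card

variable [DecidableEq V] {D : Finset V} {x y : V}

theorem ConnSet.exists_adj_of_erase (hD : ConnSet G D) (hx : x ∈ D)
    (hxD : ConnSet G (D.erase x)) : ∃ a ∈ D.erase x, G.Adj a x := by
  obtain ⟨a, ha, b, hb, hbx, hab⟩ := hD.2 _ (D.erase_subset x) hxD.1
    fun h => Finset.erase_eq_self.1 h hx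
  obtain rfl : b = x := by
    by_contra h
    exact hbx (Finset.mem_erase.2 ⟨h, hb⟩)
  exact ⟨a, ha, hab⟩

theorem IsMinConnDom.exists_private (hD : IsMinConnDom G D) (hx : x ∈ D)
    (hxD : ConnSet G (D.erase x)) :
    ∃ x', x' ∉ D ∧ G.Adj x x' ∧ ∀ d ∈ D, d ≠ x → ¬ G.Adj d x' := by
  have hdom : ¬ IsDomSet G (D.erase x) := fun h =>
    (Finset.card_erase_lt_of_mem hx).not_ge (hD.2.2 _ hxD h)
  simp only [IsDomSet] at hdom
  push Not at hdom
  obtain ⟨x', h1, h2⟩ := hdom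
  have h2' : ∀ d ∈ D, d ≠ x → ¬ G.Adj d x' := fun d hd hdx => h2 d (Finset.mem_erase.2 ⟨hdx, hd⟩)
  have hx' : x' ∉ D := fun h => by
    obtain rfl : x' = x := by
      by_contra hne
      exact h1 (Finset.mem_erase.2 ⟨hne, h⟩)
    obtain ⟨a, ha, hax⟩ := hD.1.exists_adj_of_erase hx hxD
    exact h2 a ha hax
  obtain ⟨d, hd, hdx'⟩ := (hD.2.1 x').resolve_left hx'
  obtain rfl : d = x := by
    by_contra hne
    exact h2' d hd hne hdx'
  exact ⟨x', hx', hdx', h2'⟩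

theorem IsMinConnDom.dist_le_two (hP5 : IsFree G (pathGraph 5)) (hD : IsMinConnDom G D)
    (hx : x ∈ D) (hxD : ConnSet G (D.erase x)) :
    ∀ d ∈ D, d = x ∨ G.Adj x d ∨ ∃ m ∈ D, G.Adj x m ∧ G.Adj m d := by
  classical
  obtain ⟨x', -, hxx', hx'⟩ := hD.exists_private hx hxD
  by_contra! hcon
  obtain ⟨d, hd, hd1, hd2, hd3⟩ := hcon
  obtain ⟨a, ha, b, hb, hbT, hab⟩ := hD.1.2
    (D.filter fun d => d = x ∨ G.Adj x d ∨ ∃ m ∈ D, G.Adj x m ∧ G.Adj m d)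
    (Finset.filter_subset _ _) ⟨x, by simp [hx]⟩ fun h => by
      rcases (Finset.mem_filter.1 (h.symm ▸ hd)).2 with h | h | ⟨m, hm, h1, h2⟩
      exacts [hd1 h, hd2 h, hd3 m hm h1 h2]
  simp only [Finset.mem_filter, hb, true_and] at ha hbT
  push Not at hbT
  obtain ⟨hb1, hb2, hb3⟩ := hbT
  obtain ⟨haD, rfl | hxa | ⟨m, hm, hxm, hma⟩⟩ := ha
  · exact hb2 hab
  · exact hb3 a haD hxa hab
  · have hax : ¬ G.Adj x a := fun h => hb3 a haD h hab
    have hne : a ≠ x := by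
      rintro rfl
      exact hb2 hab
    exact hP5.not_pathGraph_five x' x m a b ⟨hxx'.symm, hxm, hma, hab,
      fun h => hx' m hm hxm.ne' h.symm, fun h => hx' a haD hne h.symm,
      fun h => hx' b hb hb1 h.symm, hax, hb2, hb3 m hm hxm⟩

theorem IsMinConnDom.exists_exchange (hP5 : IsFree G (pathGraph 5)) (hD : IsMinConnDom G D)
    (hx : x ∈ D) (hxD : ConnSet G (D.erase x)) (hy : y ∈ D) (hyD : ConnSet G (D.erase y))
    (hne : x ≠ y) (hxy : ¬ G.Adj x y) :
    ∃ x', x' ∉ D ∧ G.Adj x x' ∧ (∀ d ∈ D, d ≠ x → ¬ G.Adj d x') ∧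
      IsMinConnDom G (insert x' (D.erase y)) ∧ ∀ d ∈ D, d ≠ x → d ≠ y → G.Adj x d := by
  obtain ⟨x', hx'D, hxx', hx'⟩ := hD.exists_private hx hxD
  obtain ⟨m, hm, hxm, hmy⟩ :=
    ((hD.dist_le_two hP5 hx hxD y hy).resolve_left hne.symm).resolve_left hxy
  have hxy' : x ∈ D.erase y := Finset.mem_erase.2 ⟨hne, hx⟩
  have hmy' : m ∈ D.erase y := Finset.mem_erase.2 ⟨hmy.ne, hm⟩
  have hmin : IsMinConnDom G (insert x' (D.erase y)) := by
    refine ⟨hyD.insert_of_adj hxy' hxx', fun v => ?_, fun D' h1 h2 => ?_⟩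
    · by_contra! hcon
      obtain ⟨h1, h2⟩ := hcon
      have h2' : ∀ d ∈ D, d ≠ y → ¬ G.Adj d v := fun d hd hdy =>
        h2 d (Finset.mem_insert_of_mem (Finset.mem_erase.2 ⟨hdy, hd⟩))
      have hvy : v ≠ y := by
        rintro rfl
        exact h2' m hm hmy.ne hmy
      have hvD : v ∉ D := fun h =>
        h1 (Finset.mem_insert_of_mem (Finset.mem_erase.2 ⟨hvy, h⟩))
      obtain ⟨d, hd, hdv⟩ := (hD.2.1 v).resolve_left hvD
      obtain rfl : d = y := by
        by_contra h
        exact h2' d hd h hdv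
      exact hP5.not_pathGraph_five x' x m d v ⟨hxx'.symm, hxm, hmy, hdv,
        fun h => hx' m hm hxm.ne' h.symm, fun h => hx' d hd hne.symm h.symm,
        h2 x' (Finset.mem_insert_self _ _), hxy, h2' x hx hne, h2' m hm hmy.ne⟩
    · refine le_trans (Finset.card_insert_le _ _) ?_
      rw [Finset.card_erase_add_one hy]
      exact hD.2.2 D' h1 h2
  refine ⟨x', hx'D, hxx', hx', hmin, fun d hd hdx hdy => ?_⟩
  have hx'y : x' ∉ D.erase y := fun h => hx'D (Finset.mem_of_mem_erase h)
  have hdD := hmin.dist_le_two hP5 (Finset.mem_insert_self _ _)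
    (by rwa [Finset.erase_insert hx'y]) d
    (Finset.mem_insert_of_mem (Finset.mem_erase.2 ⟨hdy, hd⟩))
  rcases hdD with rfl | h | ⟨l, hl, hxl, hld⟩
  · exact absurd hd hx'D
  · exact absurd h.symm (hx' d hd hdx)
  · rcases Finset.mem_insert.1 hl with rfl | hl
    · exact absurd hxl G.irrefl
    · obtain rfl : l = x := by
        by_contra h
        exact hx' l (Finset.mem_of_mem_erase hl) h hxl.symm
      exact hld

theorem IsMinConnDom.card_le_three_of_not_adj (hP5 : IsFree G (pathGraph 5))
    (hD : IsMinConnDom G D) (hx : x ∈ D) (hxD : ConnSet G (D.erase x)) (hy : y ∈ D)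
    (hyD : ConnSet G (D.erase y)) (hne : x ≠ y) (hxy : ¬ G.Adj x y) : D.card ≤ 3 := by
  by_contra! hcard
  have hyx : y ∈ D.erase x := Finset.mem_erase.2 ⟨hne.symm, hy⟩
  obtain ⟨m, hm, n, hn, hmn⟩ : ∃ m ∈ (D.erase x).erase y, ∃ n ∈ (D.erase x).erase y, m ≠ n := by
    rw [← Finset.one_lt_card, Finset.card_erase_of_mem hyx, Finset.card_erase_of_mem hx]
    omega
  simp only [Finset.mem_erase] at hm hn
  obtain ⟨hmy, hmx, hmD⟩ := hm
  obtain ⟨hny, hnx, hnD⟩ := hn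
  obtain ⟨x', hx'D, hxx', hx', hmin, hadj⟩ := hD.exists_exchange hP5 hx hxD hy hyD hne hxy
  have hx'y : x' ∉ D.erase y := fun h => hx'D (Finset.mem_of_mem_erase h)
  have hx'm : x' ≠ m := fun h => hx'D (h ▸ hmD)
  have hx'n : n ≠ x' := fun h => hx'D (h ▸ hnD)
  have hstar : ConnSet G ((insert x' (D.erase y)).erase m) := by
    refine connSet_of_forall_adj (p := x) (by simp [hx, hne, hmx.symm]) fun a ha hax => ?_
    simp only [Finset.mem_erase, Finset.mem_insert] at ha
    obtain ⟨-, rfl | ⟨hay, haD⟩⟩ := ha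
    · exact hxx'
    · exact hadj a haD hax hay
  obtain ⟨-, -, -, -, -, h⟩ := hmin.exists_exchange hP5 (Finset.mem_insert_self _ _)
    (by rwa [Finset.erase_insert hx'y]) (y := m) (by simp [hmy, hmD])
    hstar hx'm fun h => hx' m hmD hmx h.symm
  exact hx' n hnD hnx (h n (by simp [hny, hnD]) hx'n hmn.symm).symm

theorem ConnSet.exists_erase_of_not_adj (hD : ConnSet G D) (hx : x ∈ D) (hy : y ∈ D)
    (hne : x ≠ y) (hxy : ¬ G.Adj x y) :
    ∃ z ∈ D, x ≠ z ∧ ¬ G.Adj x z ∧ ConnSet G (D.erase z) := by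
  classical
  obtain ⟨z, hz, hzC, hzD⟩ := hD.exists_erase (C := D.filter fun d => d = x ∨ G.Adj x d)
    (connSet_of_forall_adj (p := x) (by simp [hx]) fun a ha hax =>
      (Finset.mem_filter.1 ha).2.resolve_left hax)
    (Finset.filter_ssubset.2 ⟨y, hy, by simp [hne.symm, hxy]⟩)
  simp only [Finset.mem_filter, hz, true_and, not_or] at hzC
  exact ⟨z, hz, Ne.symm hzC.1, hzC.2, hzD⟩

theorem IsMinConnDom.card_le_three (hK4 : IsFree G (⊤ : SimpleGraph (Fin 4)))
    (hP5 : IsFree G (pathGraph 5)) (hD : IsMinConnDom G D) : D.card ≤ 3 := by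
  by_cases hcl : G.IsClique (D : Set V)
  · by_contra! hcard
    have hfree : G.CliqueFree 4 := by
      by_contra h
      exact hK4 ⟨topEmbeddingOfNotCliqueFree h⟩
    exact hfree.mono hcard D ⟨hcl, rfl⟩
  · simp only [isClique_iff, Set.Pairwise] at hcl
    push Not at hcl
    obtain ⟨p, hp, q, hq, hne, hpq⟩ := hcl
    obtain ⟨x, hx, hpx, hpx', hxD⟩ := hD.1.exists_erase_of_not_adj hp hq hne hpq
    obtain ⟨y, hy, hxy, hxy', hyD⟩ := hD.1.exists_erase_of_not_adj hx hp hpx.symm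
      fun h => hpx' h.symm
    exact hD.card_le_three_of_not_adj hP5 hx hxD hy hyD hxy hxy'

omit [DecidableEq V] in
theorem domNum_le_three [Fintype V] (hG : G.Connected) (hK4 : IsFree G (⊤ : SimpleGraph (Fin 4)))
    (hP5 : IsFree G (pathGraph 5)) : domNum G ≤ 3 := by
  classical
  obtain ⟨D, hD⟩ := (Set.toFinite {D | ConnSet G D ∧ IsDomSet G D}).exists_minimalFor
    Finset.card _ ⟨Finset.univ, connSet_univ hG, fun v => Or.inl (Finset.mem_univ v)⟩
  refine (domNum_le_card hD.prop.2).trans (IsMinConnDom.card_le_three hK4 hP5 ⟨hD.prop.1,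
    hD.prop.2, fun D' h1 h2 => ?_⟩)
  by_contra! h
  exact h.not_ge (hD.le_of_le ⟨h1, h2⟩ h.le)

end ConnectedDomination

theorem stmt_2 {V W : Type*} [Fintype V] [Fintype W] (G : SimpleGraph V) (hconn : G.Connected)
    (hK4 : IsFree G (⊤ : SimpleGraph (Fin 4)))
    (hP5 : IsFree G (pathGraph 5)) (H : SimpleGraph W) :
    domNum G * domNum H ≤ domNum (G □ H) := by
  classical
  obtain ⟨v⟩ := id hconn.nonempty
  have := hconn.nonempty
  obtain ⟨D, hD, hsum⟩ := exists_covers_sum_card_eq G H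
  rw [← hsum]
  have h3 := domNum_le_three hconn hK4 hP5
  have hpair : ∀ x y, 3 ≤ domNum G ∨ 2 ≤ domNum G ∧ x = y → (coNbrs G x y).Nonempty := by
    intro x y h
    by_contra hcon
    have hdom : IsDomSet G {x, y} := fun z => by
      by_contra! hz
      simp only [Finset.mem_insert, Finset.mem_singleton, not_or, forall_eq_or_imp,
        forall_eq] at hz
      exact hcon ⟨z, (compl_adj _ _ _).2 ⟨Ne.symm hz.1.1, hz.2.1⟩,
        (compl_adj _ _ _).2 ⟨Ne.symm hz.1.2, hz.2.2⟩⟩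
    have hle := domNum_le_card hdom
    rcases h with h | ⟨h, rfl⟩
    · exact absurd (Finset.card_le_two (a := x) (b := y)) (by omega)
    · simp at hle
      omega
  interval_cases hk : domNum G
  · simp
  · simpa using domNum_le_sum_of_covers hD v
  · exact two_mul_domNum_le_sum_of_covers hD
      (fun x => (hpair x x (Or.inr ⟨le_rfl, rfl⟩)).imp fun _ h => h.1) v
  · exact three_mul_domNum_le_sum hK4 hP5 (fun x y => hpair x y (Or.inl le_rfl)) hD
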